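/- Let S ⊆ ℝ³ be a nonempty set and let P_xy : ℝ³ → ℝ² denote the projection onto the first two coordinates. Then the following are equivalent: (i) the only map η of the form η(x₁,x₂,x₃) = λ(−x₂, x₁, 0) + c, with λ ∈ ℝ and c ∈ ℝ³, satisfying η(s) = 0 for all s ∈ S is the zero map; (ii) the only map of the form x ↦ R_θ x + t, with θ ∈ ℝ and t ∈ ℝ³, fixing every point of S is the identity map; (iii) P_xy(S) contains at least two points. -/

import Mathlib

/-- Rotation by angle θ about the z-axis. -/
noncomputable def Rot (θ : ℝ) (x : Fin 3 → ℝ) : Fin 3 → ℝ :=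
  ![x 0 * Real.cos θ - x 1 * Real.sin θ, x 0 * Real.sin θ + x 1 * Real.cos θ, x 2]

/-- A multiple of the infinitesimal rotation about the z-axis plus a constant, in coordinates. -/
theorem smul_infinitesimal_rotation_add_eq_zero_iff (lam : ℝ) (c x : Fin 3 → ℝ) :
    lam • ![-(x 1), x 0, (0 : ℝ)] + c = 0 ↔
      -(lam * x 1) + c 0 = 0 ∧ lam * x 0 + c 1 = 0 ∧ c 2 = 0 := by
  simp [funext_iff, Fin.forall_fin_succ, Matrix.vecHead, Matrix.vecTail]

theorem Rot_add_eq_self_iff (θ : ℝ) (t x : Fin 3 → ℝ) :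
    Rot θ x + t = x ↔
      x 0 * Real.cos θ - x 1 * Real.sin θ + t 0 = x 0 ∧
        x 0 * Real.sin θ + x 1 * Real.cos θ + t 1 = x 1 ∧ t 2 = 0 := by
  simp [Rot, funext_iff, Fin.forall_fin_succ, Matrix.vecHead, Matrix.vecTail]

/-- A plane rotation fixing a nonzero vector is trivial. -/
theorem cos_eq_one_and_sin_eq_zero_of_fixes {θ a b : ℝ} (hab : a ≠ 0 ∨ b ≠ 0)
    (h₀ : a * Real.cos θ - b * Real.sin θ = a) (h₁ : a * Real.sin θ + b * Real.cos θ = b) :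
    Real.cos θ = 1 ∧ Real.sin θ = 0 := by
  have hpos : a ^ 2 + b ^ 2 ≠ 0 := by
    rcases hab with h | h <;> positivity
  constructor
  · apply mul_left_cancel₀ hpos
    linear_combination a * h₀ + b * h₁
  · apply mul_left_cancel₀ hpos
    linear_combination a * h₁ - b * h₀

theorem stmt17 (S : Set (Fin 3 → ℝ)) (hS : S.Nonempty) :
    -- (i) ↔ (iii)
    ((∀ (lam : ℝ) (c : Fin 3 → ℝ),
        (∀ s ∈ S, lam • ![-(s 1), s 0, (0 : ℝ)] + c = 0) →
        ∀ x : Fin 3 → ℝ, lam • ![-(x 1), x 0, (0 : ℝ)] + c = 0) ↔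
      (∃ s ∈ S, ∃ t ∈ S, s 0 ≠ t 0 ∨ s 1 ≠ t 1)) ∧
    -- (ii) ↔ (iii)
    ((∀ (θ : ℝ) (t : Fin 3 → ℝ),
        (∀ s ∈ S, Rot θ s + t = s) → ∀ x : Fin 3 → ℝ, Rot θ x + t = x) ↔
      (∃ s ∈ S, ∃ t ∈ S, s 0 ≠ t 0 ∨ s 1 ≠ t 1)) := by
  simp only [smul_infinitesimal_rotation_add_eq_zero_iff, Rot_add_eq_self_iff]
  obtain ⟨p, hp⟩ := hS
  refine ⟨⟨fun h => ?_, ?_⟩, ⟨fun h => ?_, ?_⟩⟩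
  · by_contra! hne
    have key := (h 1 ![p 1, -p 0, 0] fun s hs => by simp [hne s hs p hp]) ![p 0 + 1, p 1, 0]
    simp at key
  · rintro ⟨s, hs, t, ht, hst⟩ lam c h x
    obtain ⟨hs₀, hs₁, hs₂⟩ := h s hs
    obtain ⟨ht₀, ht₁, -⟩ := h t ht
    have hlam : lam = 0 := by
      rcases hst with hst | hst
      · apply (mul_eq_zero.mp _).resolve_right (sub_ne_zero.mpr hst)
        linear_combination hs₁ - ht₁
      · apply (mul_eq_zero.mp _).resolve_right (sub_ne_zero.mpr hst)
        linear_combination ht₀ - hs₀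
    subst hlam
    simp_all
  · by_contra! hne
    have key := (h Real.pi ![2 * p 0, 2 * p 1, 0] fun s hs => by
      obtain ⟨h₀, h₁⟩ := hne s hs p hp
      simp only [h₀, h₁, Real.cos_pi, Real.sin_pi]
      refine ⟨?_, ?_, rfl⟩ <;> simp <;> ring) ![p 0 + 1, p 1, 0]
    simp at key
    linarith [key.1]
  · rintro ⟨s, hs, t, ht, hst⟩ θ c h x
    obtain ⟨hs₀, hs₁, hs₂⟩ := h s hs
    obtain ⟨ht₀, ht₁, -⟩ := h t ht
    obtain ⟨hcos, hsin⟩ := cos_eq_one_and_sin_eq_zero_of_fixes (θ := θ)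
      (hst.imp sub_ne_zero.mpr sub_ne_zero.mpr)
      (by linear_combination hs₀ - ht₀) (by linear_combination hs₁ - ht₁)
    simp_all
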